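/- There exist constants C > 0 and ε₁ > 0 such that for all ε ∈ (0, ε₁), the following two estimates hold: |∫_{−∞}^{∞} e^{− i z/(24 ε³)} (y(z) + 2i)^{−7} (y(z) − 2i)^{−5} dz + (1/40960) √(π/2) ε^{−15/2} e^{−1/(3ε³)}| ≤ C ε^{−6} e^{−1/(3ε³)}, and |∫_{−∞}^{∞} e^{− i z/(24 ε³)} y(z) (y(z) + 2i)^{−7} (y(z) − 2i)^{−5} dz − (i/20480) √(π/2) ε^{−15/2} e^{−1/(3ε³)}| ≤ C ε^{−6} e^{−1/(3ε³)}. -/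

import Mathlib

open MeasureTheory

/-- `y(z) = (√(z² + 64) + z)^{1/3} − (√(z² + 64) − z)^{1/3}`. -/
noncomputable def yy (z : ℝ) : ℝ :=
  (Real.sqrt (z ^ 2 + 64) + z) ^ ((1 : ℝ) / 3) - (Real.sqrt (z ^ 2 + 64) - z) ^ ((1 : ℝ) / 3)

section

open Complex Filter Topology

theorem yy_cubic (z : ℝ) : yy z ^ 3 + 12 * yy z = 2 * z := by
  have hs : |z| < √(z ^ 2 + 64) := by
    rw [← Real.sqrt_sq_eq_abs]
    exact Real.sqrt_lt_sqrt (sq_nonneg z) (by linarith)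
  obtain ⟨h₁, h₂⟩ := abs_lt.mp hs
  set s := √(z ^ 2 + 64) with hsdef
  have hsq : s ^ 2 = z ^ 2 + 64 := Real.sq_sqrt (by positivity)
  have ha0 : 0 ≤ s + z := by linarith
  have hb0 : 0 ≤ s - z := by linarith
  have ha : ((s + z) ^ ((1 : ℝ) / 3)) ^ 3 = s + z := by
    rw [← Real.rpow_natCast, ← Real.rpow_mul ha0]; norm_num
  have hb : ((s - z) ^ ((1 : ℝ) / 3)) ^ 3 = s - z := by
    rw [← Real.rpow_natCast, ← Real.rpow_mul hb0]; norm_num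
  have hab : (s + z) ^ ((1 : ℝ) / 3) * (s - z) ^ ((1 : ℝ) / 3) = 4 := by
    rw [← Real.mul_rpow ha0 hb0, show (s + z) * (s - z) = 4 ^ (3 : ℝ) by norm_num; linarith,
      ← Real.rpow_mul (by norm_num)]
    norm_num
  simp only [yy, ← hsdef]
  linear_combination ha - hb + (-3 * ((s + z) ^ ((1 : ℝ) / 3) - (s - z) ^ ((1 : ℝ) / 3))) * hab

theorem cubic_injective : Function.Injective fun y : ℝ => (y ^ 3 + 12 * y) / 2 := by
  intro a b h
  have h' : (a - b) * (a ^ 2 + a * b + b ^ 2 + 12) = 0 := by simp only at h; linear_combination 2 * h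
  rcases mul_eq_zero.mp h' with h' | h'
  · linarith
  · nlinarith [sq_nonneg (a + b), sq_nonneg a, sq_nonneg b]

theorem yy_cubic_div_two (y : ℝ) : yy ((y ^ 3 + 12 * y) / 2) = y :=
  cubic_injective (by simp only; rw [yy_cubic]; ring)

theorem integral_eq_integral_comp_cubic (g : ℝ → ℂ) :
    ∫ z, g z = ∫ y : ℝ, ((3 / 2 * (y ^ 2 + 4) : ℝ) : ℂ) * g ((y ^ 3 + 12 * y) / 2) := by
  have hd : ∀ y : ℝ, HasDerivAt (fun y : ℝ => (y ^ 3 + 12 * y) / 2) (3 / 2 * (y ^ 2 + 4)) y := by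
    intro y
    refine ((((hasDerivAt_id' y).pow 3).add
      ((hasDerivAt_id' y).const_mul 12)).div_const 2).congr_deriv ?_
    norm_num
    ring
  have hsurj : Set.range (fun y : ℝ => (y ^ 3 + 12 * y) / 2) = Set.univ :=
    Set.range_eq_univ.mpr fun z => ⟨yy z, by rw [yy_cubic]; ring⟩
  have h := integral_image_eq_integral_abs_deriv_smul MeasurableSet.univ
    (fun y _ => (hd y).hasDerivWithinAt) cubic_injective.injOn g
  rw [Set.image_univ, hsurj, setIntegral_univ, setIntegral_univ] at h
  rw [h]
  refine integral_congr_ae (.of_forall fun y => ?_)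
  simp only
  rw [abs_of_pos (by positivity), real_smul]

/-- The integral of a holomorphic function with quadratic decay in a horizontal strip does not
depend on the height of the line of integration. -/
theorem integral_horizontal_eq {f : ℂ → ℂ} {a b C : ℝ} (hab : a ≤ b)
    (hf : ∀ z : ℂ, a ≤ z.im → z.im ≤ b → DifferentiableAt ℂ f z)
    (hC : ∀ z : ℂ, a ≤ z.im → z.im ≤ b → ‖f z‖ ≤ C * (1 + z.re ^ 2)⁻¹) :
    ∫ x : ℝ, f (x + a * I) = ∫ x : ℝ, f (x + b * I) := by
  have h_integrable : ∀ c, a ≤ c → c ≤ b → Integrable fun x : ℝ => f (x + c * I) := by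
    intro c hac hcb
    refine (integrable_inv_one_add_sq.const_mul C).mono' ?_ (.of_forall fun x => ?_)
    · refine Continuous.aestronglyMeasurable (continuous_iff_continuousAt.mpr fun x => ?_)
      exact ContinuousAt.comp (f := fun x : ℝ => (x + c * I : ℂ)) (g := f)
        (hf _ (by simpa) (by simpa)).continuousAt (by fun_prop)
    · simpa using hC (x + c * I) (by simpa) (by simpa)
  have hlim : ∀ c, a ≤ c → c ≤ b →
      Tendsto (fun T : ℝ => ∫ x in (-T)..T, f (x + c * I)) atTop (𝓝 (∫ x : ℝ, f (x + c * I))) :=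
    fun c hac hcb => intervalIntegral_tendsto_integral (h_integrable c hac hcb)
      tendsto_neg_atTop_atBot tendsto_id
  have hside : ∀ s : ℝ → ℝ, (∀ T, s T ^ 2 = T ^ 2) →
      Tendsto (fun T : ℝ => ∫ y in a..b, f (s T + y * I)) atTop (𝓝 0) := by
    intro s hs
    have h0 : Tendsto (fun T : ℝ => C * (1 + T ^ 2)⁻¹ * |b - a|) atTop (𝓝 0) := by
      have : Tendsto (fun T : ℝ => (1 + T ^ 2)⁻¹) atTop (𝓝 0) :=
        (tendsto_atTop_add_const_left _ 1 (tendsto_pow_atTop two_ne_zero)).inv_tendsto_atTop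
      simpa using (this.const_mul C).mul_const |b - a|
    refine squeeze_zero_norm (fun T => ?_) h0
    refine intervalIntegral.norm_integral_le_of_norm_le_const fun y hy => ?_
    rw [Set.uIoc_of_le hab] at hy
    simpa [hs] using hC (s T + y * I) (by simpa using hy.1.le) (by simpa using hy.2)
  have hrect : ∀ T : ℝ, (∫ x in (-T)..T, f (x + a * I)) - (∫ x in (-T)..T, f (x + b * I)) =
      I * (∫ y in a..b, f ((-T : ℝ) + y * I)) - I * (∫ y in a..b, f (T + y * I)) := by
    intro T
    have h := integral_boundary_rect_eq_zero_of_differentiableOn f (-T + a * I) (T + b * I)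
      (fun z hz => by
        have hz2 := hz.2
        simp [Set.uIcc_of_le hab] at hz2
        exact (hf z hz2.1 hz2.2).differentiableWithinAt)
    simp only [add_re, neg_re, ofReal_re, mul_re, I_re, mul_zero, ofReal_im, I_im, mul_one,
      sub_self, add_zero, add_im, neg_im, neg_zero, mul_im, zero_add, smul_eq_mul] at h
    linear_combination h
  have h1 := (hlim a le_rfl hab).sub (hlim b hab le_rfl)
  have h2 := ((hside (fun T => -T) (by simp)).const_mul I).sub
    ((hside (fun T => T) (by simp)).const_mul I)
  simp only [← hrect, mul_zero, sub_zero] at h2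
  exact sub_eq_zero.mp (tendsto_nhds_unique h1 h2)

theorem norm_exp_sub_one_le_mul_exp {w : ℂ} {r : ℝ} (hr : 0 ≤ r) (hw : w.re ≤ r) :
    ‖exp w - 1‖ ≤ ‖w‖ * Real.exp r := by
  have h := (convex_halfSpace_re_le r).norm_image_sub_le_of_norm_hasDerivWithin_le
    (f := exp) (f' := exp) (C := Real.exp r) (x := 0) (y := w)
    (fun x _ => (hasDerivAt_exp x).hasDerivWithinAt)
    (fun x hx => by rw [norm_exp]; exact Real.exp_le_exp.mpr hx) (by simpa) (by simpa)
  simpa [mul_comm] using h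

theorem one_le_norm_add_I (t : ℝ) : 1 ≤ ‖(t + I : ℂ)‖ := by
  simpa using abs_im_le_norm (t + I : ℂ)

theorem add_I_ne_zero (t : ℝ) : (t + I : ℂ) ≠ 0 :=
  norm_pos_iff.mp (one_pos.trans_le (one_le_norm_add_I t))

theorem norm_exp_neg_add_I_sq (t : ℝ) :
    ‖exp (-(t + I) ^ 2 / 8)‖ = Real.exp (1 / 8) * Real.exp (-(1 / 8) * t ^ 2) := by
  rw [norm_exp, ← Real.exp_add]
  congr 1
  have : (-(t + I) ^ 2 / 8 : ℂ) = ((1 / 8 - t ^ 2 / 8 : ℝ) : ℂ) + ((-t / 4 : ℝ) : ℂ) * I := by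
    push_cast; linear_combination (-1 / 8) * I_sq
  rw [this, add_re, ofReal_re, re_ofReal_mul, I_re]; ring

theorem integrable_exp_neg_add_I_sq_mul {p : ℝ → ℂ} (hp : Continuous p) {c : ℝ}
    (hc : ∀ t, ‖p t‖ ≤ c) : Integrable fun t : ℝ => exp (-(t + I) ^ 2 / 8) * p t := by
  refine ((integrable_exp_neg_mul_sq (b := 1 / 8) (by norm_num)).const_mul
    (Real.exp (1 / 8) * c)).mono' (by fun_prop) (.of_forall fun t => ?_)
  rw [norm_mul, norm_exp_neg_add_I_sq]
  calc _ ≤ Real.exp (1 / 8) * Real.exp (-(1 / 8) * t ^ 2) * c := by gcongr; exact hc t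
    _ = _ := by ring

theorem continuous_add_I_inv_pow (n : ℕ) : Continuous fun t : ℝ => ((t + I : ℂ) ^ n)⁻¹ :=
  Continuous.inv₀ (by fun_prop) fun t => pow_ne_zero _ (add_I_ne_zero t)

theorem norm_add_I_inv_pow_le (n : ℕ) (t : ℝ) : ‖((t + I : ℂ) ^ n)⁻¹‖ ≤ 1 := by
  rw [norm_inv, norm_pow]
  exact inv_le_one_of_one_le₀ (one_le_pow₀ (one_le_norm_add_I t))

theorem integral_exp_neg_add_I_sq : ∫ t : ℝ, exp (-(t + I) ^ 2 / 8) = ((√(8 * Real.pi) : ℝ) : ℂ) := by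
  have h := GaussianFourier.integral_cexp_neg_mul_sq_add_real_mul_I (b := 1 / 8) (by norm_num) 1
  rw [show ((Real.pi : ℂ) / (1 / 8)) = ((8 * Real.pi : ℝ) : ℂ) by push_cast; ring,
    show (1 / 2 : ℂ) = ((1 / 2 : ℝ) : ℂ) by norm_num, ← ofReal_cpow (by positivity),
    ← Real.sqrt_eq_rpow] at h
  rw [← h]
  refine integral_congr_ae (.of_forall fun t => ?_)
  simp only [ofReal_one, one_mul]
  congr 1; ring

theorem integral_exp_neg_add_I_sq_mul_inv_pow_six :
    ∫ t : ℝ, exp (-(t + I) ^ 2 / 8) * ((t + I : ℂ) ^ 6)⁻¹ = -((√(8 * Real.pi) : ℝ) : ℂ) / 960 := by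
  have i0 : Integrable fun t : ℝ => exp (-(t + I) ^ 2 / 8) := by
    simpa using integrable_exp_neg_add_I_sq_mul (p := fun _ => 1) continuous_const
      (c := 1) (by simp)
  have hi : ∀ n : ℕ, Integrable fun t : ℝ => exp (-(t + I) ^ 2 / 8) * ((t + I : ℂ) ^ n)⁻¹ :=
    fun n => integrable_exp_neg_add_I_sq_mul (continuous_add_I_inv_pow n) (norm_add_I_inv_pow_le n)
  have hd : ∀ t : ℝ, HasDerivAt
      (fun t : ℝ => (-1 / 5 : ℂ) * (exp (-(t + I) ^ 2 / 8) * ((t + I : ℂ) ^ 5)⁻¹) +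
        (1 / 60 : ℂ) * (exp (-(t + I) ^ 2 / 8) * ((t + I : ℂ) ^ 3)⁻¹) +
        (-1 / 240 : ℂ) * (exp (-(t + I) ^ 2 / 8) * ((t + I : ℂ) ^ 1)⁻¹))
      (exp (-(t + I) ^ 2 / 8) * ((t + I : ℂ) ^ 6)⁻¹ + (1 / 960 : ℂ) * exp (-(t + I) ^ 2 / 8)) t := by
    intro t
    have hv := add_I_ne_zero t
    have h1 : HasDerivAt (fun t : ℝ => (t + I : ℂ)) 1 t := ofRealCLM.hasDerivAt.add_const I
    have he := ((h1.pow 2).neg.div_const 8).cexp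
    have hn := fun n : ℕ => he.mul ((h1.pow n).inv (pow_ne_zero n hv))
    refine ((((hn 5).const_mul (-1 / 5)).add ((hn 3).const_mul (1 / 60))).add
      ((hn 1).const_mul (-1 / 240))).congr_deriv ?_
    simp only [Pi.pow_apply, Pi.neg_apply, Pi.inv_apply]
    field_simp
    ring
  have h := integral_eq_zero_of_hasDerivAt_of_integrable hd ((hi 6).add (i0.const_mul _))
    ((((hi 5).const_mul _).add ((hi 3).const_mul _)).add ((hi 1).const_mul _))
  rw [integral_add (hi 6) (i0.const_mul _), integral_const_mul, integral_exp_neg_add_I_sq] at h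
  linear_combination h

/-- The integrand after the substitution `z = (y³ + 12y) / 2`, with `δ ^ 2 = ε ^ 3`. -/
noncomputable def saddleIntegrand (g : ℂ → ℂ) (δ : ℝ) (y : ℂ) : ℂ :=
  exp (-(I * (y ^ 3 + 12 * y)) / (48 * (δ : ℂ) ^ 2)) * g y / ((y + 2 * I) ^ 6 * (y - 2 * I) ^ 4)

theorem norm_exp_cubic_le_one {δ : ℝ} {z : ℂ} (h₁ : -2 ≤ z.im) (h₂ : z.im ≤ 0) :
    ‖exp (-(I * (z ^ 3 + 12 * z)) / (48 * (δ : ℂ) ^ 2))‖ ≤ 1 := by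
  have hre : (-(I * (z ^ 3 + 12 * z)) / (48 * (δ : ℂ) ^ 2)).re =
      z.im * (3 * z.re ^ 2 + (12 - z.im ^ 2)) / (48 * δ ^ 2) := by
    rw [show (48 * (δ : ℂ) ^ 2) = ((48 * δ ^ 2 : ℝ) : ℂ) by push_cast; ring, div_ofReal_re]
    congr 1
    simp [pow_succ]
    ring
  rw [norm_exp, Real.exp_le_one_iff, hre]
  exact div_nonpos_of_nonpos_of_nonneg
    (mul_nonpos_of_nonpos_of_nonneg h₂ (by nlinarith [sq_nonneg z.re])) (by positivity)

theorem norm_saddleIntegrand_le {g : ℂ → ℂ} (hb : ∀ y : ℂ, y.im ≤ 0 → ‖g y‖ ≤ ‖y - 2 * I‖)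
    {δ : ℝ} (hδ : 0 < δ) {z : ℂ} (h₁ : δ - 2 ≤ z.im) (h₂ : z.im ≤ 0) :
    ‖saddleIntegrand g δ z‖ ≤ (δ ^ 6)⁻¹ * (1 + z.re ^ 2)⁻¹ := by
  have hp : δ ≤ ‖z + 2 * I‖ := by
    have := abs_im_le_norm (z + 2 * I)
    have h := le_abs_self (z + 2 * I).im
    simp at this h
    linarith
  have hN : 1 + z.re ^ 2 ≤ ‖z - 2 * I‖ ^ 2 := by
    rw [← normSq_eq_norm_sq, normSq_apply]
    simp
    nlinarith
  have hN1 : 1 ≤ ‖z - 2 * I‖ := by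
    nlinarith [norm_nonneg (z - 2 * I), sq_nonneg z.re]
  have hp0 : 0 < ‖z + 2 * I‖ := hδ.trans_le hp
  have hN0 : 0 < ‖z - 2 * I‖ := one_pos.trans_le hN1
  rw [saddleIntegrand, norm_div, norm_mul, norm_mul, norm_pow, norm_pow, ← mul_inv]
  set N := ‖z - 2 * I‖
  rw [div_le_iff₀ (by positivity), ← div_eq_inv_mul, le_div_iff₀ (by positivity)]
  calc ‖exp (-(I * (z ^ 3 + 12 * z)) / (48 * (δ : ℂ) ^ 2))‖ * ‖g z‖ * (δ ^ 6 * (1 + z.re ^ 2))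
      ≤ 1 * N * (‖z + 2 * I‖ ^ 6 * N ^ 2) := by
        gcongr
        · exact norm_exp_cubic_le_one (by linarith) h₂
        · exact hb z h₂
    _ = ‖z + 2 * I‖ ^ 6 * N ^ 3 := by ring
    _ ≤ ‖z + 2 * I‖ ^ 6 * N ^ 4 := by gcongr; norm_num

theorem integral_saddleIntegrand_eq_shift {g : ℂ → ℂ} (hd : Differentiable ℂ g)
    (hb : ∀ y : ℂ, y.im ≤ 0 → ‖g y‖ ≤ ‖y - 2 * I‖) {δ : ℝ} (hδ : 0 < δ) (hδ1 : δ ≤ 1) :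
    ∫ x : ℝ, saddleIntegrand g δ x = ∫ x : ℝ, saddleIntegrand g δ (x + (δ - 2 : ℝ) * I) := by
  have h := integral_horizontal_eq (f := saddleIntegrand g δ) (a := δ - 2) (b := 0)
    (C := (δ ^ 6)⁻¹) (by linarith) (fun z h₁ h₂ => ?_)
    (fun z h₁ h₂ => norm_saddleIntegrand_le hb hδ h₁ h₂)
  · simpa using h.symm
  · have hp : z + 2 * I ≠ 0 := fun h => by
      have := congrArg im h
      simp at this
      linarith
    have hm : z - 2 * I ≠ 0 := fun h => by
      have := congrArg im h
      simp at this
      linarith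
    unfold saddleIntegrand
    have := hd z
    fun_prop (disch := simp_all)

/-- The part of the rescaled integrand that tends to a constant as `δ → 0`. -/
noncomputable def saddleRemainder (g : ℂ → ℂ) (δ : ℝ) (v : ℂ) : ℂ :=
  exp (-(I * δ * v ^ 3) / 48) * (g (δ * v - 2 * I) / (δ * v - 4 * I) ^ 4)

theorem saddleIntegrand_rescale (g : ℂ → ℂ) {δ : ℝ} (hδ : 0 < δ) (v : ℂ) :
    saddleIntegrand g δ (δ * v - 2 * I) =
      ((Real.exp (-1 / (3 * δ ^ 2)) * (δ ^ 6)⁻¹ : ℝ) : ℂ) *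
        (exp (-v ^ 2 / 8) * ((v ^ 6)⁻¹ * saddleRemainder g δ v)) := by
  have hδ' : (δ : ℂ) ≠ 0 := by exact_mod_cast hδ.ne'
  have he : exp (-(I * ((δ * v - 2 * I) ^ 3 + 12 * (δ * v - 2 * I))) / (48 * (δ : ℂ) ^ 2)) =
      ((Real.exp (-1 / (3 * δ ^ 2)) : ℝ) : ℂ) * exp (-v ^ 2 / 8) *
        exp (-(I * δ * v ^ 3) / 48) := by
    rw [ofReal_exp, ← exp_add, ← exp_add]
    congr 1
    push_cast
    field_simp
    ring_nf
    simp only [I_sq, I_pow_three, I_pow_four]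
    ring
  rw [saddleIntegrand, he, saddleRemainder, show δ * v - 2 * I + 2 * I = δ * v by ring,
    show δ * v - 2 * I - 2 * I = δ * v - 4 * I by ring, mul_pow]
  push_cast
  simp only [div_eq_mul_inv, mul_inv]
  ring

theorem integral_saddleIntegrand {g : ℂ → ℂ} (hd : Differentiable ℂ g)
    (hb : ∀ y : ℂ, y.im ≤ 0 → ‖g y‖ ≤ ‖y - 2 * I‖) {δ : ℝ} (hδ : 0 < δ) (hδ1 : δ ≤ 1) :
    ∫ x : ℝ, saddleIntegrand g δ x = ((Real.exp (-1 / (3 * δ ^ 2)) * (δ ^ 5)⁻¹ : ℝ) : ℂ) *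
      ∫ t : ℝ, exp (-(t + I) ^ 2 / 8) * (((t + I : ℂ) ^ 6)⁻¹ * saddleRemainder g δ (t + I)) := by
  have h := Measure.integral_comp_mul_left
    (fun x : ℝ => saddleIntegrand g δ (x + (δ - 2 : ℝ) * I)) δ
  rw [← integral_saddleIntegrand_eq_shift hd hb hδ hδ1, abs_of_pos (by positivity), real_smul] at h
  have h' : ∀ t : ℝ, saddleIntegrand g δ ((δ * t : ℝ) + (δ - 2 : ℝ) * I) =
      ((Real.exp (-1 / (3 * δ ^ 2)) * (δ ^ 6)⁻¹ : ℝ) : ℂ) * (exp (-(t + I) ^ 2 / 8) *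
        (((t + I : ℂ) ^ 6)⁻¹ * saddleRemainder g δ (t + I))) := by
    intro t
    rw [← saddleIntegrand_rescale g hδ]
    congr 1
    push_cast
    ring
  simp only [h'] at h
  rw [integral_const_mul] at h
  have hδ' : (δ : ℂ) ≠ 0 := by exact_mod_cast hδ.ne'
  have h2 := congrArg (fun w : ℂ => δ * w) h
  simp only [ofReal_inv, mul_inv_cancel_left₀ hδ'] at h2
  rw [← h2]
  push_cast
  field_simp

theorem norm_saddleRemainder_sub_le {g : ℂ → ℂ} (hL : ∀ x y, ‖g x - g y‖ ≤ ‖x - y‖)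
    (hb : ∀ y : ℂ, y.im ≤ 0 → ‖g y‖ ≤ ‖y - 2 * I‖) {δ : ℝ} (hδ : 0 < δ) (hδ1 : δ ≤ 1) (t : ℝ) :
    ‖saddleRemainder g δ (t + I) - g (-2 * I) / 256‖ ≤
      18 * δ * ‖(t + I : ℂ)‖ ^ 3 * Real.exp (1 / 16 * t ^ 2) := by
  set v : ℂ := t + I with hv
  have hv1 : 1 ≤ ‖v‖ := one_le_norm_add_I t
  set w : ℂ := δ * v - 4 * I with hw
  have hw1 : 1 ≤ ‖w‖ := by
    have := abs_im_le_norm w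
    have h := neg_abs_le w.im
    simp [hw, hv] at this h
    linarith
  have hw0 : w ≠ 0 := norm_pos_iff.mp (one_pos.trans_le hw1)
  set c := g (δ * v - 2 * I)
  have hcw : ‖c‖ ≤ ‖w‖ := by
    have := hb (δ * v - 2 * I) (by simp [hv]; linarith)
    rwa [show δ * v - 2 * I - 2 * I = w by rw [hw]; ring] at this
  have hg0 : ‖g (-2 * I)‖ ≤ 4 := by
    have := hb (-2 * I) (by simp)
    rw [show -2 * I - 2 * I = -4 * I by ring] at this
    simpa using this
  have hcg : ‖c - g (-2 * I)‖ ≤ δ * ‖v‖ := by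
    have := hL (δ * v - 2 * I) (-2 * I)
    rw [show δ * v - 2 * I - -2 * I = δ * v by ring, norm_mul, norm_real, Real.norm_of_nonneg hδ.le]
      at this
    exact this
  have hE : ‖exp (-(I * δ * v ^ 3) / 48) - 1‖ ≤ δ * ‖v‖ ^ 3 * Real.exp (1 / 16 * t ^ 2) := by
    have hre : (-(I * δ * v ^ 3) / 48).re ≤ 1 / 16 * t ^ 2 := by
      have : (-(I * δ * v ^ 3) / 48).re = δ * (3 * t ^ 2 - 1) / 48 := by
        rw [show (48 : ℂ) = ((48 : ℝ) : ℂ) by norm_num, div_ofReal_re]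
        simp [pow_succ, hv, -mul_eq_mul_left_iff]
        ring
      rw [this]
      nlinarith [sq_nonneg t, mul_le_mul_of_nonneg_right hδ1 (sq_nonneg t)]
    refine (norm_exp_sub_one_le_mul_exp (by positivity) hre).trans ?_
    gcongr
    simp only [norm_div, norm_neg, norm_mul, norm_I, norm_real, Real.norm_of_nonneg hδ.le, norm_pow,
      one_mul]
    norm_num
    have : 0 ≤ δ * ‖v‖ ^ 3 := by positivity
    linarith
  have hR : ‖c / w ^ 4‖ ≤ 1 := by
    rw [norm_div, norm_pow, div_le_one (by positivity)]
    exact hcw.trans (le_self_pow₀ hw1 (by norm_num))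
  have hinv : ‖1 / w ^ 4 - 1 / 256‖ ≤ 4 * (δ * ‖v‖) := by
    have hwi : ‖w⁻¹‖ ≤ 1 := by rw [norm_inv]; exact inv_le_one_of_one_le₀ hw1
    have hfac : 1 / w ^ 4 - 1 / 256 = (δ * v) * (-(I / 4) * w⁻¹) *
        ((w⁻¹ + I / 4) * ((w⁻¹) ^ 2 + (I / 4) ^ 2)) := by
      rw [show (δ * v : ℂ) = w + 4 * I by rw [hw]; ring]
      field_simp
      ring_nf
      have hI5 : I ^ 5 = I := by rw [pow_succ, I_pow_four, one_mul]
      simp only [I_sq, I_pow_three, I_pow_four, hI5]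
      ring
    have hI : ‖I / 4‖ ≤ 1 := by simp; norm_num
    have hs : ‖w⁻¹ + I / 4‖ ≤ 2 := (norm_add_le _ _).trans (by linarith)
    have hs2 : ‖(w⁻¹) ^ 2 + (I / 4) ^ 2‖ ≤ 2 := by
      refine (norm_add_le _ _).trans ?_
      rw [norm_pow, norm_pow]
      have := pow_le_one₀ (n := 2) (norm_nonneg _) hwi
      have := pow_le_one₀ (n := 2) (norm_nonneg _) hI
      linarith
    rw [hfac, norm_mul, norm_mul, norm_mul (δ : ℂ), norm_mul (-(I / 4)), norm_neg, norm_mul (_ + _),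
      norm_real, Real.norm_of_nonneg hδ.le]
    calc _ ≤ δ * ‖v‖ * (1 * 1) * (2 * 2) := by gcongr
      _ = _ := by ring
  have hRsub : ‖c / w ^ 4 - g (-2 * I) / 256‖ ≤ 17 * (δ * ‖v‖) := by
    have : c / w ^ 4 - g (-2 * I) / 256 = (c - g (-2 * I)) * (w ^ 4)⁻¹ +
        g (-2 * I) * (1 / w ^ 4 - 1 / 256) := by ring
    rw [this]
    refine (norm_add_le _ _).trans ?_
    rw [norm_mul, norm_mul]
    have hwi : ‖(w ^ 4)⁻¹‖ ≤ 1 := by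
      rw [norm_inv, norm_pow]; exact inv_le_one_of_one_le₀ (one_le_pow₀ hw1)
    calc _ ≤ δ * ‖v‖ * 1 + 4 * (4 * (δ * ‖v‖)) := by gcongr
      _ = _ := by ring
  have hsplit : saddleRemainder g δ v - g (-2 * I) / 256 =
      (exp (-(I * δ * v ^ 3) / 48) - 1) * (c / w ^ 4) + (c / w ^ 4 - g (-2 * I) / 256) := by
    rw [saddleRemainder]; ring
  rw [hsplit]
  refine (norm_add_le _ _).trans ?_
  rw [norm_mul]
  have h1 : 1 ≤ Real.exp (1 / 16 * t ^ 2) := Real.one_le_exp (by positivity)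
  have h3 : ‖v‖ ≤ ‖v‖ ^ 3 := le_self_pow₀ hv1 (by norm_num)
  calc _ ≤ δ * ‖v‖ ^ 3 * Real.exp (1 / 16 * t ^ 2) * 1 + 17 * (δ * ‖v‖ ^ 3) * 1 := by
        gcongr
        linarith [mul_le_mul_of_nonneg_left h3 hδ.le]
    _ ≤ δ * ‖v‖ ^ 3 * Real.exp (1 / 16 * t ^ 2) * 1 +
        17 * (δ * ‖v‖ ^ 3) * Real.exp (1 / 16 * t ^ 2) := by gcongr
    _ = _ := by ring

theorem continuous_saddleRemainder {g : ℂ → ℂ} (hg : Continuous g) {δ : ℝ} (hδ1 : δ ≤ 1) :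
    Continuous fun t : ℝ => saddleRemainder g δ (t + I) := by
  have h : ∀ t : ℝ, (δ * (t + I) - 4 * I : ℂ) ^ 4 ≠ 0 := fun t => pow_ne_zero _ fun h => by
    have := congrArg im h
    simp at this
    linarith
  unfold saddleRemainder
  fun_prop (disch := exact h)

theorem norm_integral_saddle_sub_le {g : ℂ → ℂ} (hg : Continuous g)
    (hL : ∀ x y, ‖g x - g y‖ ≤ ‖x - y‖)
    (hb : ∀ y : ℂ, y.im ≤ 0 → ‖g y‖ ≤ ‖y - 2 * I‖) {δ : ℝ} (hδ : 0 < δ) (hδ1 : δ ≤ 1) :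
    ‖(∫ t : ℝ, exp (-(t + I) ^ 2 / 8) * (((t + I : ℂ) ^ 6)⁻¹ * saddleRemainder g δ (t + I))) -
        g (-2 * I) / 256 * (-((√(8 * Real.pi) : ℝ) : ℂ) / 960)‖ ≤
      18 * Real.exp (1 / 8) * √(Real.pi / (1 / 16)) * δ := by
  have hbound : ∀ t : ℝ, ‖exp (-(t + I) ^ 2 / 8) * (((t + I : ℂ) ^ 6)⁻¹ *
      (saddleRemainder g δ (t + I) - g (-2 * I) / 256))‖ ≤
      18 * Real.exp (1 / 8) * δ * Real.exp (-(1 / 16) * t ^ 2) := by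
    intro t
    have hv1 := one_le_norm_add_I t
    rw [norm_mul, norm_mul, norm_exp_neg_add_I_sq, norm_inv, norm_pow]
    set N := ‖(t + I : ℂ)‖
    calc _ ≤ Real.exp (1 / 8) * Real.exp (-(1 / 8) * t ^ 2) *
          ((N ^ 6)⁻¹ * (18 * δ * N ^ 3 * Real.exp (1 / 16 * t ^ 2))) := by
          gcongr; exact norm_saddleRemainder_sub_le hL hb hδ hδ1 t
      _ = 18 * Real.exp (1 / 8) * δ *
          (Real.exp (-(1 / 8) * t ^ 2) * Real.exp (1 / 16 * t ^ 2)) * (N ^ 3)⁻¹ := by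
          field_simp
      _ ≤ 18 * Real.exp (1 / 8) * δ *
          (Real.exp (-(1 / 8) * t ^ 2) * Real.exp (1 / 16 * t ^ 2)) * 1 := by
          gcongr; exact inv_le_one_of_one_le₀ (one_le_pow₀ hv1)
      _ = _ := by
          rw [← Real.exp_add, mul_one]; congr 2; ring
  have hgauss : Integrable fun t : ℝ =>
      18 * Real.exp (1 / 8) * δ * Real.exp (-(1 / 16) * t ^ 2) :=
    (integrable_exp_neg_mul_sq (by norm_num)).const_mul _
  have hi₁ : Integrable fun t : ℝ => exp (-(t + I) ^ 2 / 8) * (((t + I : ℂ) ^ 6)⁻¹ *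
      (saddleRemainder g δ (t + I) - g (-2 * I) / 256)) := by
    refine hgauss.mono' (Continuous.aestronglyMeasurable ?_) (.of_forall hbound)
    have := continuous_saddleRemainder hg hδ1
    have := continuous_add_I_inv_pow 6
    fun_prop
  have hi₂ : Integrable fun t : ℝ =>
      g (-2 * I) / 256 * (exp (-(t + I) ^ 2 / 8) * ((t + I : ℂ) ^ 6)⁻¹) :=
    (integrable_exp_neg_add_I_sq_mul (continuous_add_I_inv_pow 6)
      (norm_add_I_inv_pow_le 6)).const_mul _
  have hsum : (∫ t : ℝ, exp (-(t + I) ^ 2 / 8) *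
      (((t + I : ℂ) ^ 6)⁻¹ * saddleRemainder g δ (t + I))) =
      (∫ t : ℝ, exp (-(t + I) ^ 2 / 8) * (((t + I : ℂ) ^ 6)⁻¹ *
        (saddleRemainder g δ (t + I) - g (-2 * I) / 256))) +
      g (-2 * I) / 256 * (-((√(8 * Real.pi) : ℝ) : ℂ) / 960) := by
    rw [← integral_exp_neg_add_I_sq_mul_inv_pow_six, ← integral_const_mul,
      ← integral_add hi₁ hi₂]
    refine integral_congr_ae (.of_forall fun t => ?_)
    ring
  rw [hsum, add_sub_cancel_right]
  refine (norm_integral_le_of_norm_le hgauss (.of_forall hbound)).trans_eq ?_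
  rw [integral_const_mul, integral_gaussian]
  ring

theorem integral_eq_integral_saddleIntegrand (g : ℂ → ℂ) {δ ε : ℝ} (hδε : δ ^ 2 = ε ^ 3) :
    (∫ z : ℝ, exp (-(I * (z : ℂ)) / (24 * (ε : ℂ) ^ 3)) * g (yy z) *
        ((yy z : ℂ) + 2 * I) ^ (-7 : ℤ) * ((yy z : ℂ) - 2 * I) ^ (-5 : ℤ)) =
      3 / 2 * ∫ y : ℝ, saddleIntegrand g δ y := by
  have hδε' : (δ : ℂ) ^ 2 = (ε : ℂ) ^ 3 := by exact_mod_cast hδε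
  rw [integral_eq_integral_comp_cubic, ← integral_const_mul]
  refine integral_congr_ae (.of_forall fun y => ?_)
  have hp : (y + 2 * I : ℂ) ≠ 0 := fun h => by simpa using congrArg im h
  have hm : (y - 2 * I : ℂ) ≠ 0 := fun h => by simpa using congrArg im h
  have hfac : (((3 / 2 * (y ^ 2 + 4) : ℝ)) : ℂ) = 3 / 2 * ((y + 2 * I) * (y - 2 * I)) := by
    push_cast
    linear_combination 6 * I_sq
  have he : (-(I * (((y ^ 3 + 12 * y) / 2 : ℝ) : ℂ)) / (24 * (ε : ℂ) ^ 3)) =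
      -(I * (y ^ 3 + 12 * y)) / (48 * (δ : ℂ) ^ 2) := by
    rw [hδε']
    push_cast
    rw [show (48 : ℂ) * (ε : ℂ) ^ 3 = 2 * (24 * ε ^ 3) by ring, ← div_div _ (2 : ℂ)]
    congr 1
    ring
  simp only [yy_cubic_div_two]
  rw [he, hfac, saddleIntegrand, zpow_neg, zpow_neg]
  norm_cast
  field_simp

theorem exists_norm_integral_sub_le {g : ℂ → ℂ} (hd : Differentiable ℂ g)
    (hL : ∀ x y, ‖g x - g y‖ ≤ ‖x - y‖) (hb : ∀ y : ℂ, y.im ≤ 0 → ‖g y‖ ≤ ‖y - 2 * I‖) :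
    ∃ C > (0 : ℝ), ∀ ε : ℝ, 0 < ε → ε < 1 →
      ‖(∫ z : ℝ, exp (-(I * (z : ℂ)) / (24 * (ε : ℂ) ^ 3)) * g (yy z) *
          ((yy z : ℂ) + 2 * I) ^ (-7 : ℤ) * ((yy z : ℂ) - 2 * I) ^ (-5 : ℤ)) +
        g (-2 * I) / 40960 * ((√(Real.pi / 2) * ε ^ (-(15 : ℝ) / 2) *
          Real.exp (-1 / (3 * ε ^ 3)) : ℝ) : ℂ)‖ ≤
        C * ε ^ (-(6 : ℝ)) * Real.exp (-1 / (3 * ε ^ 3)) := by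
  refine ⟨3 / 2 * (18 * Real.exp (1 / 8) * √(Real.pi / (1 / 16))), by positivity,
    fun ε hε hε1 => ?_⟩
  set δ : ℝ := ε ^ ((3 : ℝ) / 2) with hδdef
  have hδ : 0 < δ := Real.rpow_pos_of_pos hε _
  have hδ1 : δ ≤ 1 := Real.rpow_le_one hε.le hε1.le (by norm_num)
  have hpow : ∀ n : ℕ, δ ^ n = ε ^ ((3 : ℝ) / 2 * n) := fun n => by
    rw [hδdef, ← Real.rpow_natCast, ← Real.rpow_mul hε.le]
  have hδε : δ ^ 2 = ε ^ 3 := by rw [hpow, ← Real.rpow_natCast]; norm_num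
  have h5 : ε ^ (-(15 : ℝ) / 2) = (δ ^ 5)⁻¹ := by rw [hpow, ← Real.rpow_neg hε.le]; norm_num
  have h4 : ε ^ (-(6 : ℝ)) = (δ ^ 4)⁻¹ := by rw [hpow, ← Real.rpow_neg hε.le]; norm_num
  have hsqrt : √(8 * Real.pi) = 4 * √(Real.pi / 2) := by
    rw [show 8 * Real.pi = 4 ^ 2 * (Real.pi / 2) by ring, Real.sqrt_mul (by norm_num),
      Real.sqrt_sq (by norm_num)]
  have hmain := norm_integral_saddle_sub_le hd.continuous hL hb hδ hδ1
  rw [integral_eq_integral_saddleIntegrand g hδε, integral_saddleIntegrand hd hb hδ hδ1, h5, h4,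
    ← hδε]
  rw [hsqrt] at hmain
  set E := Real.exp (-1 / (3 * δ ^ 2))
  set J := ∫ t : ℝ, exp (-(t + I) ^ 2 / 8) * (((t + I : ℂ) ^ 6)⁻¹ * saddleRemainder g δ (t + I))
  have hEpos : 0 < E := Real.exp_pos _
  have hfac : 3 / 2 * (((E * (δ ^ 5)⁻¹ : ℝ) : ℂ) * J) +
      g (-2 * I) / 40960 * ((√(Real.pi / 2) * (δ ^ 5)⁻¹ * E : ℝ) : ℂ) =
      ((3 / 2 * (E * (δ ^ 5)⁻¹) : ℝ) : ℂ) *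
        (J - g (-2 * I) / 256 * (-((4 * √(Real.pi / 2) : ℝ) : ℂ) / 960)) := by
    push_cast
    ring
  rw [hfac, norm_mul, norm_real, Real.norm_of_nonneg (by positivity)]
  refine (mul_le_mul_of_nonneg_left hmain (by positivity)).trans_eq ?_
  field_simp

end

/-- Asymptotics of the two integrals
`∫ e^{−iz/(24ε³)} (y(z)+2i)^{−7}(y(z)−2i)^{−5} dz` and
`∫ e^{−iz/(24ε³)} y(z) (y(z)+2i)^{−7}(y(z)−2i)^{−5} dz` as `ε → 0⁺`. -/
theorem key_integral_asymptotics :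
    ∃ C > (0 : ℝ), ∃ ε₁ > (0 : ℝ), ∀ ε : ℝ, 0 < ε → ε < ε₁ →
      (‖(∫ z : ℝ,
            Complex.exp (-(Complex.I * (z : ℂ)) / (24 * (ε : ℂ) ^ 3)) *
              ((yy z : ℂ) + 2 * Complex.I) ^ (-7 : ℤ) *
              ((yy z : ℂ) - 2 * Complex.I) ^ (-5 : ℤ))
          + (((1 / 40960) * Real.sqrt (Real.pi / 2) * ε ^ (-(15 : ℝ) / 2) *
              Real.exp (-1 / (3 * ε ^ 3)) : ℝ) : ℂ)‖
        ≤ C * ε ^ (-(6 : ℝ)) * Real.exp (-1 / (3 * ε ^ 3))) ∧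
      (‖(∫ z : ℝ,
            Complex.exp (-(Complex.I * (z : ℂ)) / (24 * (ε : ℂ) ^ 3)) * (yy z : ℂ) *
              ((yy z : ℂ) + 2 * Complex.I) ^ (-7 : ℤ) *
              ((yy z : ℂ) - 2 * Complex.I) ^ (-5 : ℤ))
          - (Complex.I / 20480) *
              ((Real.sqrt (Real.pi / 2) * ε ^ (-(15 : ℝ) / 2) *
                Real.exp (-1 / (3 * ε ^ 3)) : ℝ) : ℂ)‖
        ≤ C * ε ^ (-(6 : ℝ)) * Real.exp (-1 / (3 * ε ^ 3))) := by
  obtain ⟨C₁, hC₁, h₁⟩ := exists_norm_integral_sub_le (g := fun _ => 1)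
    (differentiable_const _) (fun x y => by simp) (fun y hy => by
      have := Complex.abs_im_le_norm (y - 2 * Complex.I)
      have h := neg_abs_le (y - 2 * Complex.I).im
      simp at this h ⊢
      linarith)
  obtain ⟨C₂, hC₂, h₂⟩ := exists_norm_integral_sub_le (g := fun y => y)
    differentiable_id (fun x y => le_rfl) (fun y hy => by
      rw [← sq_le_sq₀ (norm_nonneg _) (norm_nonneg _), ← Complex.normSq_eq_norm_sq,
        ← Complex.normSq_eq_norm_sq, Complex.normSq_apply, Complex.normSq_apply]
      simp
      nlinarith)
  refine ⟨max C₁ C₂, lt_max_of_lt_left hC₁, 1, one_pos, fun ε hε hε1 => ⟨?_, ?_⟩⟩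
  · refine le_trans (le_of_eq ?_) ((h₁ ε hε hε1).trans ?_)
    · simp only [mul_one]
      congr 2
      push_cast
      ring
    · gcongr
      exact le_max_left _ _
  · refine le_trans (le_of_eq ?_) ((h₂ ε hε hε1).trans ?_)
    · rw [sub_eq_add_neg]
      congr 2
      ring
    · gcongr
      exact le_max_right _ _
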